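/- For every constant c > 0 there exist C > 0 and N such that the following holds for all n = rm ≥ N with integers r ≥ 3, m ≥ 1 and integer d with 1 ≤ d ≤ m^{r−1} − 1 satisfying Λ ≥ c·r^{16}·m^{2−r}: ∫_{𝓑 ∩ U_n(ρ₀)} |F(θ)| dθ ≤ m^{(r−1)/2} · (2π/(Λ m^{r−1}))^{(n−r+1)/2} · exp(C·(r²/(Λ m^{r−2}) + n^{−2/5})). -/

import Mathlib

open MeasureTheory Filter

/-- The edge density `λ = d / m^(r-1)`. -/
noncomputable def lam (r m d : ℕ) : ℝ := (d : ℝ) / (m : ℝ) ^ (r - 1)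

/-- `Λ = λ(1−λ)`. -/
noncomputable def Lam (r m d : ℕ) : ℝ := lam r m d * (1 - lam r m d)

/-- For an edge `e ∈ (Fin m)^r` and `θ ∈ ℝ^n` (vertices indexed by `Fin r × Fin m`,
class `t` being `{t} × Fin m`), the sum `Σ_{j∈e} θ_j`. -/
def edgeSum (r m : ℕ) (θ : Fin r × Fin m → ℝ) (e : Fin r → Fin m) : ℝ :=
  ∑ t : Fin r, θ (t, e t)

/-- The integrand `F(θ) = (∏_e (1 + λ(e^{iΣ_{j∈e}θ_j} − 1))) · e^{−i d Σ_j θ_j}`. -/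
noncomputable def Ffun (r m d : ℕ) (θ : Fin r × Fin m → ℝ) : ℂ :=
  (∏ e : Fin r → Fin m,
      (1 + (lam r m d : ℂ) * (Complex.exp (Complex.I * (edgeSum r m θ e : ℂ)) - 1))) *
    Complex.exp (-Complex.I * (d : ℂ) * ((∑ p : Fin r × Fin m, θ p : ℝ) : ℂ))

/-- Vertex `p` is one of the constrained coordinates `2m, 3m, …, rm`
(the last vertex of each class except the first). -/
def constrained (r m : ℕ) (p : Fin r × Fin m) : Prop := p.1.val ≠ 0 ∧ p.2.val = m - 1

instance (r m : ℕ) : DecidablePred (constrained r m) :=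
  fun p => inferInstanceAs (Decidable (p.1.val ≠ 0 ∧ p.2.val = m - 1))

/-- Extension by zero of a vector of free coordinates to all of `ℝ^n`;
(n−r+1)-dimensional integrals over subsets of `𝓑` are realised by pulling back along it. -/
def ext (r m : ℕ) (θ : {p : Fin r × Fin m // ¬ constrained r m p} → ℝ) :
    Fin r × Fin m → ℝ :=
  fun p => if h : constrained r m p then 0 else θ ⟨p, h⟩

/-- `ρ₀ = r^{5/2} (log n) / (Λ m^{r−1})^{1/2}`, with `n = r·m`. -/
noncomputable def rho0 (r m d : ℕ) : ℝ :=
  (r : ℝ) ^ ((5 : ℝ) / 2) * Real.log ((r : ℝ) * m) /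
    Real.sqrt (Lam r m d * (m : ℝ) ^ (r - 1))

/-- `U_n(ρ) = {x ∈ ℝ^n : ‖x‖_∞ ≤ ρ}`. -/
def Uball (r m : ℕ) (ρ : ℝ) : Set (Fin r × Fin m → ℝ) := {θ | ∀ p, |θ p| ≤ ρ}

/-- `𝓑 = {θ ∈ U_n(π) : θ_{2m} = ⋯ = θ_{rm} = 0}`. -/
def BSet (r m : ℕ) : Set (Fin r × Fin m → ℝ) :=
  {θ | (∀ p, |θ p| ≤ Real.pi) ∧ ∀ p, constrained r m p → θ p = 0}

/-- The circular distance `|x|_{2π} = min_{k∈ℤ} |x − 2πk|`. -/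
noncomputable def circ (x : ℝ) : ℝ := ⨅ k : ℤ, |x - 2 * Real.pi * k|

/-- The main factor `m^{(r−1)/2} (2π/(Λ m^{r−1}))^{(n−r+1)/2}` in the estimates. -/
noncomputable def denseBound (r m d : ℕ) : ℝ :=
  (m : ℝ) ^ (((r : ℝ) - 1) / 2) *
    (2 * Real.pi / (Lam r m d * (m : ℝ) ^ (r - 1))) ^
      ((((r * m : ℕ) : ℝ) - (r : ℝ) + 1) / 2)

/-- First, second and fourth moments of a sum of independent centred variables, each
uniform on `m` values. -/
theorem sum_moments_of_centered (m k : ℕ) (φ : Fin k → Fin m → ℝ)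
    (hφ : ∀ t, ∑ j, φ t j = 0) :
    (∑ e : Fin k → Fin m, ∑ t, φ t (e t) = 0) ∧
    ((m : ℝ) * ∑ e : Fin k → Fin m, (∑ t, φ t (e t)) ^ 2 =
      (m : ℝ) ^ k * ∑ t, ∑ j, φ t j ^ 2) ∧
    ((m : ℝ) ^ 2 * ∑ e : Fin k → Fin m, (∑ t, φ t (e t)) ^ 4 ≤
      (m : ℝ) ^ k * (3 * (∑ t, ∑ j, φ t j ^ 2) ^ 2 + m * ∑ t, ∑ j, φ t j ^ 4)) := by
  induction k with
  | zero => simp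
  | succ k ih =>
    obtain ⟨h1, h2, h4⟩ := ih (fun t => φ t.succ) (fun t => hφ t.succ)
    set T : (Fin k → Fin m) → ℝ := fun e => ∑ t, φ t.succ (e t) with hT
    replace h1 : ∑ e, T e = 0 := h1
    replace h2 : (m : ℝ) * ∑ e, T e ^ 2 = (m : ℝ) ^ k * ∑ t : Fin k, ∑ j, φ t.succ j ^ 2 := h2
    replace h4 : (m : ℝ) ^ 2 * ∑ e, T e ^ 4 ≤ (m : ℝ) ^ k *
      (3 * (∑ t : Fin k, ∑ j, φ t.succ j ^ 2) ^ 2 + m * ∑ t : Fin k, ∑ j, φ t.succ j ^ 4) := h4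
    have hsplit : ∀ G : ℝ → ℝ, ∑ e : Fin (k + 1) → Fin m, G (∑ t, φ t (e t)) =
        ∑ j, ∑ e : Fin k → Fin m, G (φ 0 j + T e) := by
      intro G
      rw [← (Fin.consEquiv (fun _ : Fin (k + 1) => Fin m)).sum_comp, Fintype.sum_prod_type]
      simp [Fin.consEquiv, Fin.sum_univ_succ, hT]
    have hcard : (Finset.univ : Finset (Fin k → Fin m)).card = m ^ k := by simp
    have e1 : ∑ j, ∑ e : Fin k → Fin m, (φ 0 j + T e) = 0 := by
      simp only [Finset.sum_add_distrib, h1, Finset.sum_const, hcard]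
      rw [← Finset.smul_sum, hφ 0]; simp
    have e2 : ∑ j, ∑ e : Fin k → Fin m, (φ 0 j + T e) ^ 2 =
        (m : ℝ) ^ k * ∑ j, φ 0 j ^ 2 + m * ∑ e, T e ^ 2 := by
      have : ∀ j e, (φ 0 j + T e) ^ 2 = φ 0 j ^ 2 + 2 * φ 0 j * T e + T e ^ 2 := by
        intros; ring
      simp only [this, Finset.sum_add_distrib, ← Finset.mul_sum, h1, Finset.sum_const, hcard,
        nsmul_eq_mul]
      simp
    have e4 : ∑ j, ∑ e : Fin k → Fin m, (φ 0 j + T e) ^ 4 =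
        (m : ℝ) ^ k * ∑ j, φ 0 j ^ 4 + 6 * (∑ j, φ 0 j ^ 2) * (∑ e, T e ^ 2)
          + m * ∑ e, T e ^ 4 := by
      have : ∀ j e, (φ 0 j + T e) ^ 4 = φ 0 j ^ 4 + 4 * φ 0 j ^ 3 * T e
          + 6 * φ 0 j ^ 2 * T e ^ 2 + 4 * φ 0 j * T e ^ 3 + T e ^ 4 := by
        intros; ring
      simp only [this, Finset.sum_add_distrib, ← Finset.mul_sum, ← Finset.sum_mul, h1,
        Finset.sum_const, hcard, nsmul_eq_mul, hφ 0]
      simp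
    refine ⟨?_, ?_, ?_⟩
    · rw [hsplit (fun x => x)]; exact e1
    · rw [hsplit (fun x => x ^ 2), e2, Fin.sum_univ_succ, mul_add, ← mul_assoc, ← mul_assoc,
        mul_assoc (m : ℝ) (m : ℝ), h2]
      ring
    · rw [hsplit (fun x => x ^ 4), e4, Fin.sum_univ_succ, Fin.sum_univ_succ]
      have hk : 0 ≤ (m : ℝ) ^ k := by positivity
      have hm : (0 : ℝ) ≤ m := by positivity
      have h4' := mul_le_mul_of_nonneg_left h4 hm
      have hx : (m : ℝ) * (6 * ∑ j, φ 0 j ^ 2) * (m * ∑ e, T e ^ 2) =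
        (m : ℝ) * (6 * ∑ j, φ 0 j ^ 2) * ((m : ℝ) ^ k * ∑ t : Fin k, ∑ j, φ t.succ j ^ 2) := by
        rw [h2]
      have hq : 0 ≤ (m : ℝ) * m ^ k * (∑ j, φ 0 j ^ 2) ^ 2 := by positivity
      rw [pow_succ (m : ℝ) k]
      nlinarith [h4', hx, hq]

/-- The mean of `x` over the class `t`. -/
noncomputable def classMean (r m : ℕ) (x : Fin r × Fin m → ℝ) (t : Fin r) : ℝ :=
  (∑ j, x (t, j)) / m

/-- Centre every class but the first and move the class means into the first class. -/
noncomputable def recenter (r m : ℕ) (x : Fin r × Fin m → ℝ) : Fin r × Fin m → ℝ :=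
  fun p => if p.1.val = 0 then x p + ∑ t : Fin r, (if t.val = 0 then 0 else classMean r m x t)
    else x p - classMean r m x p.1

theorem sum_recenter_eq_zero {r m : ℕ} (hm : 0 < m) (x : Fin r × Fin m → ℝ) {t : Fin r}
    (ht : t.val ≠ 0) : ∑ j, recenter r m x (t, j) = 0 := by
  have : (m : ℝ) ≠ 0 := by positivity
  simp only [recenter, ht, if_false, Finset.sum_sub_distrib, classMean]
  simp [mul_div_cancel₀ _ this]

theorem edgeSum_recenter (k m : ℕ) (x : Fin (k + 1) × Fin m → ℝ) (e : Fin (k + 1) → Fin m) :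
    edgeSum (k + 1) m (recenter (k + 1) m x) e = edgeSum (k + 1) m x e := by
  simp [edgeSum, recenter, Fin.sum_univ_succ, Finset.sum_sub_distrib]

/-- Second and fourth moments of the edge sums of a vector that is centred
on all classes but the first. -/
theorem edgeSum_moments_of_centered (k m : ℕ) (hm : 0 < m) (y : Fin (k + 1) × Fin m → ℝ)
    (hy : ∀ t : Fin (k + 1), t.val ≠ 0 → ∑ j, y (t, j) = 0) :
    (∑ e, edgeSum (k + 1) m y e ^ 2 = (m : ℝ) ^ k * ∑ p, y p ^ 2) ∧
    (∑ e, edgeSum (k + 1) m y e ^ 4 ≤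
      8 * (m : ℝ) ^ k * ∑ p, y p ^ 4 + 24 * (m : ℝ) ^ k / m * (∑ p, y p ^ 2) ^ 2) := by
  obtain ⟨h1, h2, h4⟩ := sum_moments_of_centered m k (fun t j => y (t.succ, j))
    (fun t => hy t.succ (by simp))
  have hm' : (0 : ℝ) < m := by positivity
  set T : (Fin k → Fin m) → ℝ := fun e => ∑ t, y (t.succ, e t) with hT
  replace h1 : ∑ e, T e = 0 := h1
  replace h2 : (m : ℝ) * ∑ e, T e ^ 2 =
    (m : ℝ) ^ k * ∑ t : Fin k, ∑ j, y (t.succ, j) ^ 2 := h2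
  replace h4 : (m : ℝ) ^ 2 * ∑ e, T e ^ 4 ≤ (m : ℝ) ^ k *
    (3 * (∑ t : Fin k, ∑ j, y (t.succ, j) ^ 2) ^ 2 +
      m * ∑ t : Fin k, ∑ j, y (t.succ, j) ^ 4) := h4
  have hsplit : ∀ G : ℝ → ℝ, ∑ e : Fin (k + 1) → Fin m, G (edgeSum (k + 1) m y e) =
      ∑ j, ∑ e : Fin k → Fin m, G (y (0, j) + T e) := by
    intro G
    rw [← (Fin.consEquiv (fun _ : Fin (k + 1) => Fin m)).sum_comp, Fintype.sum_prod_type]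
    simp [Fin.consEquiv, Fin.sum_univ_succ, hT, edgeSum]
  have hcard : (Finset.univ : Finset (Fin k → Fin m)).card = m ^ k := by simp
  have hS : ∀ l : ℕ, ∑ p, y p ^ l =
      ∑ j, y (0, j) ^ l + ∑ t : Fin k, ∑ j, y (t.succ, j) ^ l := by
    intro l
    rw [Fintype.sum_prod_type, Fin.sum_univ_succ]
  constructor
  · rw [hsplit (fun x => x ^ 2), hS]
    have : ∀ j e, (y (0, j) + T e) ^ 2 = y (0, j) ^ 2 + 2 * y (0, j) * T e + T e ^ 2 := by
      intros; ring
    simp only [this, Finset.sum_add_distrib, ← Finset.mul_sum, h1, Finset.sum_const, hcard,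
      nsmul_eq_mul, Finset.card_univ, Fintype.card_fin, h2]
    simp only [mul_zero, Finset.sum_const_zero]
    push_cast
    ring
  · rw [hsplit (fun x => x ^ 4), hS, hS]
    have hb : ∑ j, ∑ e : Fin k → Fin m, (y (0, j) + T e) ^ 4 ≤
        ∑ j, ∑ e : Fin k → Fin m, (8 * y (0, j) ^ 4 + 8 * T e ^ 4) := by
      gcongr with j _ e _
      nlinarith [sq_nonneg (y (0, j) - T e), sq_nonneg (y (0, j) + T e),
        sq_nonneg (y (0, j) ^ 2 - T e ^ 2), sq_nonneg ((y (0, j) - T e) ^ 2)]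
    refine hb.trans ?_
    simp only [Finset.sum_add_distrib, ← Finset.mul_sum, Finset.sum_const, hcard,
      nsmul_eq_mul, Finset.card_univ, Fintype.card_fin]
    set W := ∑ t : Fin k, ∑ j, y (t.succ, j) ^ 2
    set K := ∑ t : Fin k, ∑ j, y (t.succ, j) ^ 4
    set q := ∑ j, y (0, j) ^ 2
    have hq : 0 ≤ q := by positivity
    have hW : 0 ≤ W := by positivity
    have h4' : (m : ℝ) * ∑ e, T e ^ 4 ≤ (m : ℝ) ^ k / m * (3 * W ^ 2 + m * K) := by
      have : (m : ℝ) * ∑ e, T e ^ 4 = ((m : ℝ) ^ 2 * ∑ e, T e ^ 4) / m := by field_simp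
      rw [this, div_mul_eq_mul_div]
      gcongr
    have h5 : (m : ℝ) ^ k / m * (3 * W ^ 2 + m * K) =
        3 * ((m : ℝ) ^ k / m) * W ^ 2 + (m : ℝ) ^ k * K := by field_simp
    have h6 : (m : ℝ) ^ k / m * W ^ 2 ≤ (m : ℝ) ^ k / m * (q + W) ^ 2 := by
      gcongr; linarith
    push_cast
    have h7 : 24 * (m : ℝ) ^ k / m * (q + W) ^ 2 = 24 * ((m : ℝ) ^ k / m * (q + W) ^ 2) := by ring
    rw [h7]
    nlinarith [h4', h5, h6]

theorem norm_one_add_mul_exp_sub_one_le {l x : ℝ} (hl : 0 ≤ l * (1 - l)) (hx : |x| ≤ 1) :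
    ‖1 + (l : ℂ) * (Complex.exp (Complex.I * (x : ℂ)) - 1)‖ ≤
      Real.exp (l * (1 - l) * (-(x ^ 2 / 2) + 5 / 96 * x ^ 4)) := by
  have hsq : ‖1 + (l : ℂ) * (Complex.exp (Complex.I * (x : ℂ)) - 1)‖ ^ 2 =
      1 - 2 * (l * (1 - l)) * (1 - Real.cos x) := by
    rw [← Complex.normSq_eq_norm_sq, mul_comm Complex.I, Complex.exp_mul_I,
      ← Complex.ofReal_cos, ← Complex.ofReal_sin, Complex.normSq_apply]
    simp only [Complex.add_re, Complex.add_im, Complex.mul_re, Complex.mul_im, Complex.one_re,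
      Complex.one_im, Complex.sub_re, Complex.sub_im, Complex.ofReal_re, Complex.ofReal_im,
      Complex.I_re, Complex.I_im]
    linear_combination l ^ 2 * Real.sin_sq_add_cos_sq x
  have hcos := (abs_le.1 (Real.cos_bound hx)).2
  have h4 : |x| ^ 4 = x ^ 4 := by rw [show 4 = 2 * 2 from rfl, pow_mul, sq_abs, ← pow_mul]
  rw [h4] at hcos
  refine abs_le_of_sq_le_sq' ?_ (Real.exp_pos _).le |>.2
  rw [hsq, ← Real.exp_nat_mul]
  refine le_trans ?_ (Real.add_one_le_exp _)
  push_cast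
  nlinarith [mul_le_mul_of_nonneg_left hcos hl]

theorem norm_Ffun_le (k m d : ℕ) (hm : 0 < m) (hL : 0 ≤ Lam (k + 1) m d)
    (x : Fin (k + 1) × Fin m → ℝ) (hx : ∀ e, |edgeSum (k + 1) m x e| ≤ 1) :
    ‖Ffun (k + 1) m d x‖ ≤ Real.exp (Lam (k + 1) m d * (m : ℝ) ^ k *
      (-(1 / 2) * ∑ p, recenter (k + 1) m x p ^ 2 +
        5 / 12 * ∑ p, recenter (k + 1) m x p ^ 4 +
        5 / 4 / m * (∑ p, recenter (k + 1) m x p ^ 2) ^ 2)) := by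
  obtain ⟨h2, h4⟩ := edgeSum_moments_of_centered k m hm (recenter (k + 1) m x)
    (fun t ht => sum_recenter_eq_zero hm x ht)
  simp only [edgeSum_recenter] at h2 h4
  have hphase : ‖Complex.exp (-Complex.I * (d : ℂ) * ((∑ p, x p : ℝ) : ℂ))‖ = 1 := by
    rw [Complex.norm_exp]; simp
  rw [Ffun, norm_mul, hphase, mul_one, norm_prod]
  calc _ ≤ ∏ e, Real.exp (Lam (k + 1) m d * (-(edgeSum (k + 1) m x e ^ 2 / 2)
          + 5 / 96 * edgeSum (k + 1) m x e ^ 4)) :=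
        Finset.prod_le_prod (fun _ _ => norm_nonneg _)
          (fun e _ => norm_one_add_mul_exp_sub_one_le hL (hx e))
    _ ≤ _ := by
      rw [← Real.exp_sum, Real.exp_le_exp, ← Finset.mul_sum, Finset.sum_add_distrib,
        Finset.sum_neg_distrib, ← Finset.mul_sum, ← Finset.sum_div, h2, mul_assoc]
      refine mul_le_mul_of_nonneg_left ?_ hL
      have : 24 * (m : ℝ) ^ k / m * (∑ p, recenter (k + 1) m x p ^ 2) ^ 2 =
        24 * ((m : ℝ) ^ k * (1 / m * (∑ p, recenter (k + 1) m x p ^ 2) ^ 2)) := by ring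
      rw [this] at h4
      have h0 : 0 ≤ (m : ℝ) ^ k * ∑ p, recenter (k + 1) m x p ^ 4 := by positivity
      have : 5 / 4 / (m : ℝ) * (∑ p, recenter (k + 1) m x p ^ 2) ^ 2 =
        5 / 4 * (1 / m * (∑ p, recenter (k + 1) m x p ^ 2) ^ 2) := by ring
      rw [this]
      linarith

/-- A linear map that adds to the coordinates satisfying `q` a function of the other
coordinates preserves volume. -/
theorem measurePreserving_add_of_shear {ι : Type*} [Fintype ι] [DecidableEq ι] (q : ι → Prop)
    [DecidablePred q] (g : (ι → ℝ) → ι → ℝ) (hg : IsLinearMap ℝ g)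
    (hsupp : ∀ x i, ¬ q i → g x i = 0)
    (hker : ∀ x, (∀ i, ¬ q i → x i = 0) → g x = 0) :
    MeasurePreserving (fun x : ι → ℝ => x + g x) := by
  set N : (ι → ℝ) →ₗ[ℝ] (ι → ℝ) := hg.mk' g with hN
  set D : Matrix ι ι ℝ := Matrix.diagonal fun i => if q i then 1 else 0 with hD
  have hDN : D * LinearMap.toMatrix' N = LinearMap.toMatrix' N := by
    ext i j
    rw [hD, Matrix.diagonal_mul]
    by_cases h : q i
    · simp [h]
    · simp [h, LinearMap.toMatrix'_apply, hN, hsupp _ i h]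
  have hND : LinearMap.toMatrix' N * D = 0 := by
    ext i j
    rw [hD, Matrix.mul_diagonal]
    by_cases h : q j
    · have : g (Pi.single j 1) = 0 := by
        refine hker _ fun i hi => ?_
        rw [Pi.single_apply, if_neg]
        rintro rfl
        exact hi h
      simp [h, LinearMap.toMatrix'_apply, hN, this]
    · simp [h]
  have hdet : LinearMap.det (LinearMap.id + N) = 1 := by
    rw [← LinearMap.det_toMatrix', map_add, LinearMap.toMatrix'_id, ← hDN,
      Matrix.det_one_add_mul_comm, hND, add_zero, Matrix.det_one]
  have hmap := Real.map_linearMap_volume_pi_eq_smul_volume_pi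
    (f := LinearMap.id + N) (by rw [hdet]; exact one_ne_zero)
  rw [hdet] at hmap
  refine ⟨(LinearMap.id + N).continuous_of_finiteDimensional.measurable, ?_⟩
  simp only [inv_one, abs_one, ENNReal.ofReal_one, one_smul] at hmap
  exact hmap

/-- Set the constrained coordinates to zero. -/
def maskFree (r m : ℕ) (x : Fin r × Fin m → ℝ) : Fin r × Fin m → ℝ :=
  fun p => if constrained r m p then 0 else x p

/-- Copy the constrained coordinate of each class but the first to the whole class. -/
def spread (r m : ℕ) (hm : 0 < m) (x : Fin r × Fin m → ℝ) : Fin r × Fin m → ℝ :=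
  fun p => if p.1.val = 0 then 0 else x (p.1, ⟨m - 1, Nat.sub_lt hm one_pos⟩)

theorem classMean_add {r m : ℕ} (x y : Fin r × Fin m → ℝ) (t : Fin r) :
    classMean r m (x + y) t = classMean r m x t + classMean r m y t := by
  simp [classMean, Finset.sum_add_distrib, add_div]

theorem classMean_smul {r m : ℕ} (c : ℝ) (x : Fin r × Fin m → ℝ) (t : Fin r) :
    classMean r m (c • x) t = c * classMean r m x t := by
  simp [classMean, ← Finset.mul_sum, mul_div_assoc]

theorem maskFree_add {r m : ℕ} (x y : Fin r × Fin m → ℝ) :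
    maskFree r m (x + y) = maskFree r m x + maskFree r m y := by
  ext p; by_cases h : constrained r m p <;> simp [maskFree, h]

theorem maskFree_smul {r m : ℕ} (c : ℝ) (x : Fin r × Fin m → ℝ) :
    maskFree r m (c • x) = c • maskFree r m x := by
  ext p; by_cases h : constrained r m p <;> simp [maskFree, h]

theorem measurePreserving_recenter_add_spread (r m : ℕ) (hm : 0 < m) :
    MeasurePreserving (fun x : Fin r × Fin m → ℝ =>
      recenter r m (maskFree r m x) + spread r m hm x) := by
  have s1 := measurePreserving_add_of_shear (fun p : Fin r × Fin m => p.1.val = 0)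
    (fun x p => if p.1.val = 0 then
      ∑ t : Fin r, (if t.val = 0 then 0 else classMean r m (maskFree r m x) t) else 0)
    (by
      constructor
      · intro x y
        ext p
        by_cases h : p.1.val = 0
        · simp only [h, if_true, Pi.add_apply, maskFree_add, classMean_add,
            ← Finset.sum_add_distrib]
          refine Finset.sum_congr rfl fun t _ => ?_
          split_ifs <;> simp
        · simp [h]
      · intro c x
        ext p
        by_cases h : p.1.val = 0
        · simp [h, maskFree_smul, classMean_smul, Finset.mul_sum]
        · simp [h])
    (by intro x p hp; simp [hp])
    (by
      intro x hx
      ext p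
      by_cases h : p.1.val = 0
      · simp only [h, if_true, Pi.zero_apply]
        refine Finset.sum_eq_zero fun t _ => ?_
        by_cases ht : t.val = 0
        · simp [ht]
        · simp [ht, classMean, maskFree, hx (t, _) ht]
      · simp [h])
  have s2 := measurePreserving_add_of_shear (constrained r m)
    (fun x p => if constrained r m p then - classMean r m (maskFree r m x) p.1 else 0)
    (by
      constructor
      · intro x y
        ext p
        by_cases h : constrained r m p
        · simp [h, maskFree_add, classMean_add]; ring
        · simp [h]
      · intro c x
        ext p
        by_cases h : constrained r m p <;> simp [h, maskFree_smul, classMean_smul])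
    (by intro x p hp; simp [hp])
    (by
      intro x hx
      have : maskFree r m x = 0 := by
        ext p
        by_cases h : constrained r m p
        · simp [maskFree, h]
        · simp [maskFree, h, hx p h]
      ext p
      simp [this, classMean])
  have s3 := measurePreserving_add_of_shear (fun p => ¬ constrained r m p)
    (fun x p => if constrained r m p then 0 else spread r m hm x p)
    (by
      constructor
      · intro x y
        ext p
        by_cases h : constrained r m p
        · simp [h]
        · by_cases h0 : p.1.val = 0 <;> simp [h, spread, h0]
      · intro c x
        ext p
        by_cases h : constrained r m p <;> simp [h, spread])
    (by intro x p hp; simp [not_not.1 hp])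
    (by
      intro x hx
      ext p
      by_cases h : constrained r m p
      · simp [h]
      · by_cases h0 : p.1.val = 0
        · simp [h, spread, h0]
        · simp [h, spread, h0, hx (p.1, ⟨m - 1, _⟩) (not_not.2 ⟨h0, rfl⟩)])
  convert s3.comp (s2.comp s1) using 1
  ext x p
  have hmean : ∀ t : Fin r, t.val ≠ 0 → ∀ u : Fin r × Fin m → ℝ,
      classMean r m (maskFree r m (x + fun p => if p.1.val = 0 then u p else 0)) t =
        classMean r m (maskFree r m x) t := by
    intro t ht u
    simp [classMean, maskFree, ht]
  obtain ⟨t, j⟩ := p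
  by_cases ht : t.val = 0
  · have hc : ¬ constrained r m (t, j) := fun h => h.1 ht
    simp [hc, ht, spread, recenter, maskFree]
  · have hl : constrained r m (t, ⟨m - 1, Nat.sub_lt hm one_pos⟩) := ⟨ht, rfl⟩
    by_cases hc : constrained r m (t, j)
    · have hj : j = ⟨m - 1, Nat.sub_lt hm one_pos⟩ := Fin.ext hc.2
      simp only [Function.comp_apply, Pi.add_apply, hc, if_true, recenter, spread, ht, if_false,
        add_zero]
      rw [hmean t ht (fun _ => _), ← hj]
      simp [maskFree, hc]
      ring
    · simp only [Function.comp_apply, Pi.add_apply, hc, recenter, spread, ht, if_false,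
        add_zero, hl, if_true]
      rw [hmean t ht (fun _ => _)]
      simp [maskFree, hc]
      ring

theorem sum_constrained (r m : ℕ) (hm : 0 < m) (f : Fin r × Fin m → ℝ) :
    ∑ p : {p // constrained r m p}, f p =
      ∑ t : Fin r, if t.val = 0 then 0 else f (t, ⟨m - 1, Nat.sub_lt hm one_pos⟩) := by
  rw [← Finset.sum_subtype (Finset.univ.filter (constrained r m)) (by simp) f,
    Finset.sum_filter, Fintype.sum_prod_type]
  refine Finset.sum_congr rfl fun t _ => ?_
  by_cases ht : t.val = 0
  · simp [constrained, ht]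
  · rw [if_neg ht, Finset.sum_eq_single ⟨m - 1, Nat.sub_lt hm one_pos⟩]
    · simp [constrained, ht]
    · intro j _ hj
      exact if_neg fun h => hj (Fin.ext h.2)
    · simp

theorem card_constrained (k m : ℕ) (hm : 0 < m) :
    Fintype.card {p // constrained (k + 1) m p} = k := by
  have h := sum_constrained (k + 1) m hm (fun _ => 1)
  simp [Fin.sum_univ_succ] at h
  exact_mod_cast h

theorem sum_spread_sq (r m : ℕ) (hm : 0 < m) (x : Fin r × Fin m → ℝ) :
    ∑ p, spread r m hm x p ^ 2 = m * ∑ p : {p // constrained r m p}, x p ^ 2 := by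
  rw [sum_constrained r m hm (fun p => x p ^ 2), Fintype.sum_prod_type, Finset.mul_sum]
  refine Finset.sum_congr rfl fun t _ => ?_
  by_cases ht : t.val = 0 <;> simp [spread, ht]

theorem sum_recenter_mul_spread (r m : ℕ) (hm : 0 < m) (x y : Fin r × Fin m → ℝ) :
    ∑ p, recenter r m x p * spread r m hm y p = 0 := by
  rw [Fintype.sum_prod_type]
  refine Finset.sum_eq_zero fun t _ => ?_
  by_cases ht : t.val = 0
  · simp [spread, ht]
  · simp only [spread, ht, if_false]
    rw [← Finset.sum_mul, sum_recenter_eq_zero hm x ht, zero_mul]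

/-- Flip the sign of the constrained coordinates. -/
def flipConstrained (r m : ℕ) (x : Fin r × Fin m → ℝ) : Fin r × Fin m → ℝ :=
  fun p => if constrained r m p then - x p else x p

theorem measurePreserving_flipConstrained (r m : ℕ) :
    MeasurePreserving (flipConstrained r m) := by
  have : flipConstrained r m = fun x p => (if constrained r m p then (- ·) else id) (x p) := by
    ext x p
    by_cases h : constrained r m p <;> simp [flipConstrained, h]
  rw [this]
  refine volume_preserving_pi (f := fun p => if constrained r m p then (- ·) else id) fun p => ?_
  by_cases h : constrained r m p
  · simpa [h] using Measure.measurePreserving_neg (volume : Measure ℝ)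
  · simpa [h] using MeasurePreserving.id (volume : Measure ℝ)

theorem maskFree_flipConstrained {r m : ℕ} (x : Fin r × Fin m → ℝ) :
    maskFree r m (flipConstrained r m x) = maskFree r m x := by
  ext p
  by_cases h : constrained r m p <;> simp [maskFree, flipConstrained, h]

theorem spread_flipConstrained {r m : ℕ} (hm : 0 < m) (x : Fin r × Fin m → ℝ) :
    spread r m hm (flipConstrained r m x) = - spread r m hm x := by
  ext p
  by_cases h : p.1.val = 0 <;> simp [spread, flipConstrained, constrained, h]

theorem exp_sum_mul_exp_sum_le (r m : ℕ) (hm : 0 < m) (a : ℝ) (h : ℝ → ℝ)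
    (hconv : ∀ y b, h y ≤ (h (y + b) + h (y - b)) / 2) (z : Fin r × Fin m → ℝ) :
    Real.exp (∑ p, (-a * recenter r m (maskFree r m z) p ^ 2 +
        h (recenter r m (maskFree r m z) p))) *
      Real.exp (∑ p : {p // constrained r m p}, -(a * m) * z p ^ 2) ≤
    1 / 2 * Real.exp (∑ p, (-a * (recenter r m (maskFree r m z) + spread r m hm z) p ^ 2 +
        h ((recenter r m (maskFree r m z) + spread r m hm z) p))) +
    1 / 2 * Real.exp (∑ p, (-a * (recenter r m (maskFree r m z) - spread r m hm z) p ^ 2 +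
        h ((recenter r m (maskFree r m z) - spread r m hm z) p))) := by
  set Y := recenter r m (maskFree r m z) with hY
  set B := spread r m hm z with hB
  have hcross : ∑ p, Y p * B p = 0 := sum_recenter_mul_spread r m hm _ _
  have hBsq := sum_spread_sq r m hm z
  rw [← hB] at hBsq
  have h1 : ∑ p, (Y + B) p ^ 2 = ∑ p, Y p ^ 2 + ∑ p, B p ^ 2 := by
    have : ∀ p, (Y + B) p ^ 2 = Y p ^ 2 + 2 * (Y p * B p) + B p ^ 2 := by
      intro p; simp only [Pi.add_apply]; ring
    simp only [this, Finset.sum_add_distrib, ← Finset.mul_sum, hcross]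
    ring
  have h2 : ∑ p, (Y - B) p ^ 2 = ∑ p, Y p ^ 2 + ∑ p, B p ^ 2 := by
    have : ∀ p, (Y - B) p ^ 2 = Y p ^ 2 - 2 * (Y p * B p) + B p ^ 2 := by
      intro p; simp only [Pi.sub_apply]; ring
    simp only [this, Finset.sum_add_distrib, Finset.sum_sub_distrib, ← Finset.mul_sum, hcross]
    ring
  have h3 : ∑ p, h (Y p) ≤ (∑ p, h ((Y + B) p) + ∑ p, h ((Y - B) p)) / 2 := by
    rw [← Finset.sum_add_distrib, Finset.sum_div]
    exact Finset.sum_le_sum fun p _ => hconv (Y p) (B p)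
  rw [← Real.exp_add]
  simp only [Finset.sum_add_distrib, ← Finset.mul_sum, h1, h2]
  set c := -a * (∑ p, Y p ^ 2 + ∑ p, B p ^ 2) with hc
  have h4 : -a * ∑ p, Y p ^ 2 + ∑ p, h (Y p) +
      -(a * m) * ∑ p : {p // constrained r m p}, z p ^ 2 = c + ∑ p, h (Y p) := by
    rw [hc, hBsq]; ring
  rw [h4]
  set u := c + ∑ p, h ((Y + B) p)
  set v := c + ∑ p, h ((Y - B) p)
  calc Real.exp (c + ∑ p, h (Y p)) ≤ Real.exp ((1 / 2) * u + (1 / 2) * v) := by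
        apply Real.exp_le_exp.2; simp only [u, v]; linarith
    _ ≤ _ := by
        simpa [smul_eq_mul] using convexOn_exp.2 (Set.mem_univ u) (Set.mem_univ v)
          (by norm_num : (0 : ℝ) ≤ 1 / 2) (by norm_num : (0 : ℝ) ≤ 1 / 2) (by norm_num)

theorem measurable_recenter (r m : ℕ) : Measurable (recenter r m) := by
  refine measurable_pi_iff.2 fun p => ?_
  by_cases h : p.1.val = 0
  · simp only [recenter, h, if_true]
    refine (measurable_pi_apply p).add (Finset.measurable_sum _ fun t _ => ?_)
    by_cases ht : t.val = 0
    · simp [ht]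
    · simp only [ht, if_false, classMean]
      fun_prop
  · simp only [recenter, h, if_false, classMean]
    fun_prop

theorem measurable_ext (r m : ℕ) : Measurable (ext r m) := by
  refine measurable_pi_iff.2 fun p => ?_
  by_cases h : constrained r m p
  · simp [ext, h]
  · simp only [ext, h, dif_neg, not_false_eq_true]
    fun_prop

/-- Integrating over the free coordinates, weighted by a Gaussian integral over the
constrained ones, is dominated by a product integral over all coordinates. -/
theorem lintegral_recenter_ext_mul_le (r m : ℕ) (hm : 0 < m) (a : ℝ) (h : ℝ → ℝ)
    (hmeas : Measurable h) (hconv : ∀ y b, h y ≤ (h (y + b) + h (y - b)) / 2) :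
    (∫⁻ b : {p // constrained r m p} → ℝ,
        ENNReal.ofReal (Real.exp (∑ p, -(a * m) * b p ^ 2))) *
      (∫⁻ θ, ENNReal.ofReal (Real.exp (∑ p, (-a * recenter r m (ext r m θ) p ^ 2 +
        h (recenter r m (ext r m θ) p))))) ≤
    ∫⁻ z : Fin r × Fin m → ℝ, ENNReal.ofReal (Real.exp (∑ p, (-a * z p ^ 2 + h (z p)))) := by
  set f : ({p // ¬ constrained r m p} → ℝ) → ENNReal := fun θ =>
    ENNReal.ofReal (Real.exp (∑ p, (-a * recenter r m (ext r m θ) p ^ 2 +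
        h (recenter r m (ext r m θ) p)))) with hf
  set g : ({p // constrained r m p} → ℝ) → ENNReal := fun b =>
    ENNReal.ofReal (Real.exp (∑ p, -(a * m) * b p ^ 2)) with hg
  set Ψ : (Fin r × Fin m → ℝ) → ENNReal := fun z =>
    ENNReal.ofReal (Real.exp (∑ p, (-a * z p ^ 2 + h (z p)))) with hΨ
  have hR := measurable_recenter r m
  have hE := measurable_ext r m
  have hΨm : Measurable Ψ := by fun_prop
  have hgm : Measurable g := by fun_prop
  have hfm : Measurable f := hΨm.comp (hR.comp hE)
  have hM := measurePreserving_recenter_add_spread r m hm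
  have hF := measurePreserving_flipConstrained r m
  rw [← lintegral_prod_mul hgm.aemeasurable hfm.aemeasurable, ← Measure.volume_eq_prod,
    ← (volume_preserving_piEquivPiSubtypeProd (fun _ : Fin r × Fin m => ℝ)
      (constrained r m)).lintegral_comp
      (f := fun w => g w.1 * f w.2) (by fun_prop)]
  set T : (Fin r × Fin m → ℝ) → (Fin r × Fin m → ℝ) := fun x =>
      recenter r m (maskFree r m x) + spread r m hm x with hT
  calc _ ≤ ∫⁻ z, (ENNReal.ofReal (1 / 2) * Ψ (T z) +
            ENNReal.ofReal (1 / 2) * Ψ (T (flipConstrained r m z))) := by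
        refine lintegral_mono fun z => ?_
        have hmask : ext r m (fun p => z p) = maskFree r m z := by
          ext p
          by_cases hp : constrained r m p <;> simp [ext, maskFree, hp]
        have key := exp_sum_mul_exp_sum_le r m hm a h hconv z
        simp only [hf, hg, hΨ, hT]
        rw [maskFree_flipConstrained, spread_flipConstrained, ← sub_eq_add_neg,
          ← ENNReal.ofReal_mul (Real.exp_pos _).le,
          ← ENNReal.ofReal_mul (by norm_num), ← ENNReal.ofReal_mul (by norm_num),
          ← ENNReal.ofReal_add (by positivity) (by positivity), mul_comm]
        refine ENNReal.ofReal_le_ofReal (le_trans (le_of_eq ?_) key)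
        rw [← hmask]
        rfl
    _ = ENNReal.ofReal (1 / 2) * (∫⁻ z, Ψ z) + ENNReal.ofReal (1 / 2) * (∫⁻ z, Ψ z) := by
        have hTm : Measurable T := hM.measurable
        have hFm := hF.measurable
        rw [lintegral_add_left (by fun_prop), lintegral_const_mul _ (by fun_prop),
          lintegral_const_mul _ (by fun_prop), hM.lintegral_comp hΨm,
          hF.lintegral_comp (f := fun z => Ψ (T z)) (by fun_prop), hM.lintegral_comp hΨm]
    _ = _ := by
        rw [← add_mul, ← ENNReal.ofReal_add (by norm_num) (by norm_num)]
        norm_num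

/-- The even convex function equal to `y ^ 4` on `[-L, L]` and quadratic outside. -/
noncomputable def truncQuartic (L y : ℝ) : ℝ :=
  2 * min (y ^ 2) (L ^ 2) * y ^ 2 - min (y ^ 2) (L ^ 2) ^ 2

theorem truncQuartic_ge (L y τ : ℝ) (h1 : τ ≤ L ^ 2) :
    2 * τ * y ^ 2 - τ ^ 2 ≤ truncQuartic L y := by
  rw [truncQuartic]
  rcases le_total (y ^ 2) (L ^ 2) with h | h
  · rw [min_eq_left h]; nlinarith [sq_nonneg (y ^ 2 - τ)]
  · rw [min_eq_right h]; nlinarith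

theorem truncQuartic_midpoint (L y b : ℝ) :
    truncQuartic L y ≤ (truncQuartic L (y + b) + truncQuartic L (y - b)) / 2 := by
  set τ := min (y ^ 2) (L ^ 2) with hτ
  have h0 : 0 ≤ τ := le_min (sq_nonneg _) (sq_nonneg _)
  have h1 := truncQuartic_ge L (y + b) τ (min_le_right _ _)
  have h2 := truncQuartic_ge L (y - b) τ (min_le_right _ _)
  have h3 : truncQuartic L y = 2 * τ * y ^ 2 - τ ^ 2 := rfl
  nlinarith [mul_nonneg h0 (sq_nonneg b)]

theorem truncQuartic_eq {L y : ℝ} (h : |y| ≤ L) : truncQuartic L y = y ^ 4 := by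
  rw [truncQuartic, min_eq_left (sq_le_sq' (abs_le.1 h).1 (abs_le.1 h).2)]
  ring

theorem truncQuartic_nonneg (L y : ℝ) : 0 ≤ truncQuartic L y := by
  simpa using truncQuartic_ge L y 0 (sq_nonneg L)

theorem truncQuartic_le_pow_four (L y : ℝ) : truncQuartic L y ≤ y ^ 4 := by
  rw [truncQuartic]
  nlinarith [sq_nonneg (y ^ 2 - min (y ^ 2) (L ^ 2))]

theorem truncQuartic_le_sq (L y : ℝ) : truncQuartic L y ≤ 2 * L ^ 2 * y ^ 2 := by
  rw [truncQuartic]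
  nlinarith [sq_nonneg (min (y ^ 2) (L ^ 2)),
    mul_le_mul_of_nonneg_right (min_le_right (y ^ 2) (L ^ 2)) (sq_nonneg y)]

theorem measurable_truncQuartic (L : ℝ) : Measurable (truncQuartic L) := by
  unfold truncQuartic
  fun_prop

theorem exp_gaussian_truncQuartic_le {A L : ℝ} (hA : 0 < A) (hL : L ^ 2 ≤ 3 / 20) (y : ℝ) :
    Real.exp (-(A / 2) * y ^ 2 + 5 / 12 * A * truncQuartic L y) ≤
      Real.exp (-(A / 2) * y ^ 2) + 54 / A * Real.exp (-(A / 4) * y ^ 2) := by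
  set u := 5 / 12 * A * truncQuartic L y with hu
  have hu0 : 0 ≤ u := mul_nonneg (by positivity) (truncQuartic_nonneg L y)
  have hAy : 0 ≤ A * y ^ 2 := by positivity
  have hu1 : u ≤ A / 8 * y ^ 2 := by
    have := mul_le_mul_of_nonneg_left (truncQuartic_le_sq L y) hA.le
    nlinarith
  have hu2 : u ≤ 54 / A * Real.exp (A / 8 * y ^ 2) := by
    have h4 := mul_le_mul_of_nonneg_left (truncQuartic_le_pow_four L y) hA.le
    have he := Real.quadratic_le_exp_of_nonneg (by positivity : 0 ≤ A / 8 * y ^ 2)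
    rw [div_mul_eq_mul_div, le_div_iff₀ hA]
    nlinarith
  have hexp : Real.exp u ≤ 1 + u * Real.exp u := by
    have := Real.add_one_le_exp (-u)
    have h2 : Real.exp (-u) * Real.exp u = 1 := by rw [← Real.exp_add]; simp
    nlinarith [mul_le_mul_of_nonneg_right this (Real.exp_pos u).le]
  have hprod : u * Real.exp u ≤ 54 / A * Real.exp (A / 4 * y ^ 2) := by
    calc u * Real.exp u ≤ (54 / A * Real.exp (A / 8 * y ^ 2)) * Real.exp (A / 8 * y ^ 2) :=
          mul_le_mul hu2 (Real.exp_le_exp.2 hu1) (Real.exp_pos _).le (by positivity)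
      _ = _ := by rw [mul_assoc, ← Real.exp_add]; congr 2; ring
  rw [Real.exp_add]
  calc _ ≤ Real.exp (-(A / 2) * y ^ 2) * (1 + 54 / A * Real.exp (A / 4 * y ^ 2)) := by
        gcongr; linarith
    _ = _ := by
        rw [mul_add, mul_one, mul_left_comm, ← Real.exp_add]
        congr 3; ring

theorem integrable_gaussian_truncQuartic {A L : ℝ} (hA : 0 < A) (hL : L ^ 2 ≤ 3 / 20) :
    Integrable (fun y : ℝ => Real.exp (-(A / 2) * y ^ 2 + 5 / 12 * A * truncQuartic L y)) := by
  have hm := measurable_truncQuartic L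
  refine Integrable.mono' ((integrable_exp_neg_mul_sq (half_pos hA)).add
    ((integrable_exp_neg_mul_sq (by positivity : 0 < A / 4)).const_mul (54 / A)))
    (by fun_prop) (Eventually.of_forall fun y => ?_)
  rw [Real.norm_of_nonneg (Real.exp_pos _).le]
  exact exp_gaussian_truncQuartic_le hA hL y

theorem integral_gaussian_truncQuartic_le {A L : ℝ} (hA : 0 < A) (hL : L ^ 2 ≤ 3 / 20) :
    ∫ y : ℝ, Real.exp (-(A / 2) * y ^ 2 + 5 / 12 * A * truncQuartic L y) ≤
      √(2 * Real.pi / A) * Real.exp (108 / A) := by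
  have i1 := integrable_exp_neg_mul_sq (half_pos hA)
  have i2 := (integrable_exp_neg_mul_sq (by positivity : 0 < A / 4)).const_mul (54 / A)
  have h1 : Real.pi / (A / 2) = 2 * Real.pi / A := by field_simp
  have h2 : √(Real.pi / (A / 4)) ≤ 2 * √(2 * Real.pi / A) := by
    rw [Real.sqrt_le_left (by positivity), mul_pow, Real.sq_sqrt (by positivity)]
    have : 0 ≤ Real.pi / A := by positivity
    have e1 : Real.pi / (A / 4) = 4 * (Real.pi / A) := by field_simp
    have e2 : 2 * Real.pi / A = 2 * (Real.pi / A) := by ring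
    rw [e1, e2]; linarith
  calc _ ≤ ∫ y : ℝ, (Real.exp (-(A / 2) * y ^ 2) + 54 / A * Real.exp (-(A / 4) * y ^ 2)) :=
        integral_mono (integrable_gaussian_truncQuartic hA hL) (i1.add i2)
          (exp_gaussian_truncQuartic_le hA hL)
    _ = √(2 * Real.pi / A) + 54 / A * √(Real.pi / (A / 4)) := by
        rw [integral_add i1 i2, integral_const_mul, integral_gaussian, integral_gaussian, h1]
    _ ≤ √(2 * Real.pi / A) + 54 / A * (2 * √(2 * Real.pi / A)) := by gcongr
    _ = √(2 * Real.pi / A) * (108 / A + 1) := by ring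
    _ ≤ _ := by gcongr; exact Real.add_one_le_exp _

theorem lintegral_exp_sum {ι : Type*} [Fintype ι] (f : ℝ → ℝ)
    (hf : Integrable fun x => Real.exp (f x)) :
    ∫⁻ x : ι → ℝ, ENNReal.ofReal (Real.exp (∑ i, f (x i))) =
      ENNReal.ofReal ((∫ x, Real.exp (f x)) ^ Fintype.card ι) := by
  simp only [Real.exp_sum]
  rw [← integral_fintype_prod_volume_eq_pow, ofReal_integral_eq_lintegral_ofReal]
  · exact Integrable.fintype_prod fun _ => hf
  · exact Eventually.of_forall fun x => Finset.prod_nonneg fun i _ => (Real.exp_pos _).le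

/-- The Gaussian integral over the free coordinates of the quadratic form
`A * ∑ p, recenter θ p ^ 2 / 2`, with `k + 1` classes of size `m`. -/
noncomputable def gaussMass (k m : ℕ) (A : ℝ) : ℝ :=
  √(2 * Real.pi / A) ^ ((k + 1) * m) / √(2 * Real.pi / (A * m)) ^ k

theorem gaussMass_pos (k m : ℕ) (hm : 0 < m) {A : ℝ} (hA : 0 < A) : 0 < gaussMass k m A := by
  have := Real.pi_pos
  unfold gaussMass
  positivity

theorem lintegral_recenter_ext_le (k m : ℕ) (hm : 0 < m) {A q : ℝ} (hA : 0 < A) (h : ℝ → ℝ)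
    (hmeas : Measurable h) (hconv : ∀ y b, h y ≤ (h (y + b) + h (y - b)) / 2)
    (hint : Integrable fun y : ℝ => Real.exp (-(A / 2) * y ^ 2 + h y))
    (hle : ∫ y : ℝ, Real.exp (-(A / 2) * y ^ 2 + h y) ≤ √(2 * Real.pi / A) * Real.exp q) :
    ∫⁻ θ, ENNReal.ofReal (Real.exp (∑ p, (-(A / 2) * recenter (k + 1) m (ext (k + 1) m θ) p ^ 2 +
        h (recenter (k + 1) m (ext (k + 1) m θ) p)))) ≤
      ENNReal.ofReal (gaussMass k m A * Real.exp (((k + 1) * m : ℕ) * q)) := by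
  have hm' : (0 : ℝ) < m := by positivity
  have key := lintegral_recenter_ext_mul_le (k + 1) m hm (A / 2) h hmeas hconv
  have hpos : 0 < A / 2 * m := by positivity
  rw [lintegral_exp_sum (fun y => -(A / 2 * m) * y ^ 2) (integrable_exp_neg_mul_sq hpos),
    integral_gaussian, lintegral_exp_sum (fun y => -(A / 2) * y ^ 2 + h y) hint,
    card_constrained k m hm] at key
  have e1 : Real.pi / (A / 2 * m) = 2 * Real.pi / (A * m) := by field_simp
  rw [e1] at key
  have hw : 0 < √(2 * Real.pi / (A * m)) ^ k := by have := Real.pi_pos; positivity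
  set w := √(2 * Real.pi / (A * m)) ^ k with hwdef
  have hJ0 : 0 ≤ ∫ y : ℝ, Real.exp (-(A / 2) * y ^ 2 + h y) :=
    integral_nonneg fun _ => (Real.exp_pos _).le
  have hcard : Fintype.card (Fin (k + 1) × Fin m) = (k + 1) * m := by simp
  rw [hcard] at key
  have h2 : (∫ y : ℝ, Real.exp (-(A / 2) * y ^ 2 + h y)) ^ ((k + 1) * m) ≤
      w * (gaussMass k m A * Real.exp (((k + 1) * m : ℕ) * q)) := by
    refine (pow_le_pow_left₀ hJ0 hle _).trans (le_of_eq ?_)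
    rw [mul_pow, ← Real.exp_nat_mul, gaussMass, ← hwdef]
    field_simp
  have h3 := key.trans (ENNReal.ofReal_le_ofReal h2)
  rw [ENNReal.ofReal_mul hw.le] at h3
  exact (ENNReal.mul_le_mul_iff_right (ENNReal.ofReal_pos.2 hw).ne' ENNReal.ofReal_ne_top).1 h3

theorem gaussMass_half_le (k m : ℕ) (hm : 0 < m) {A : ℝ} (hA : 0 < A) :
    gaussMass k m (A / 2) ≤ gaussMass k m A * Real.exp (((k + 1) * m : ℕ) * (1 / 2)) := by
  have hm' : (0 : ℝ) < m := by positivity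
  have hpi := Real.pi_pos
  have e1 : 2 * Real.pi / (A / 2) = 2 * (2 * Real.pi / A) := by field_simp
  have h2 : √2 ≤ Real.exp (1 / 2) := by
    rw [Real.sqrt_le_left (Real.exp_pos _).le, ← Real.exp_nat_mul]
    norm_num
    linarith [Real.add_one_le_exp 1]
  unfold gaussMass
  have e2 : A / 2 * m ≤ A * m := by nlinarith [mul_pos hA hm']
  have hd : √(2 * Real.pi / (A * m)) ≤ √(2 * Real.pi / (A / 2 * m)) :=
    Real.sqrt_le_sqrt (div_le_div_of_nonneg_left (by positivity) (by positivity) e2)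
  rw [e1, Real.sqrt_mul (by norm_num), mul_pow, Real.exp_nat_mul,
    mul_comm (√2 ^ _), div_mul_eq_mul_div (√(2 * Real.pi / A) ^ _)]
  exact div_le_div₀ (by positivity)
    (mul_le_mul_of_nonneg_left (pow_le_pow_left₀ (by positivity) h2 _) (by positivity))
    (by positivity) (pow_le_pow_left₀ (by positivity) hd k)

theorem gaussMass_eq_denseBound (k m d : ℕ) (hm : 0 < m) (hL : 0 < Lam (k + 1) m d) :
    gaussMass k m (Lam (k + 1) m d * (m : ℝ) ^ k) = denseBound (k + 1) m d := by
  have hm' : (0 : ℝ) < m := by positivity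
  unfold gaussMass denseBound
  simp only [add_tsub_cancel_right]
  set A := Lam (k + 1) m d * (m : ℝ) ^ k with hA
  have hA0 : 0 < A := by positivity
  have hs : 0 < 2 * Real.pi / A := by have := Real.pi_pos; positivity
  have e1 : 2 * Real.pi / (A * m) = 2 * Real.pi / A / m := by field_simp
  rw [e1, Real.sqrt_div hs.le, div_pow, Real.sqrt_eq_rpow, Real.sqrt_eq_rpow,
    ← Real.rpow_natCast, ← Real.rpow_natCast, ← Real.rpow_natCast, ← Real.rpow_mul hs.le,
    ← Real.rpow_mul hs.le, ← Real.rpow_mul hm'.le, div_div_eq_mul_div, mul_comm, mul_div_assoc,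
    ← Real.rpow_sub hs]
  congr 2 <;> push_cast <;> ring

theorem abs_classMean_le {r m : ℕ} (hm : 0 < m) {x : Fin r × Fin m → ℝ} {ρ : ℝ}
    (hx : ∀ p, |x p| ≤ ρ) (t : Fin r) : |classMean r m x t| ≤ ρ := by
  have hm' : (0 : ℝ) < m := by positivity
  rw [classMean, abs_div, abs_of_pos hm', div_le_iff₀ hm']
  calc _ ≤ ∑ j, |x (t, j)| := Finset.abs_sum_le_sum_abs _ _
    _ ≤ ∑ _j : Fin m, ρ := Finset.sum_le_sum fun j _ => hx (t, j)
    _ = ρ * m := by simp [mul_comm]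

theorem abs_recenter_le {k m : ℕ} (hk : 1 ≤ k) (hm : 0 < m) {x : Fin (k + 1) × Fin m → ℝ}
    {ρ : ℝ} (hx : ∀ p, |x p| ≤ ρ) (p : Fin (k + 1) × Fin m) :
    |recenter (k + 1) m x p| ≤ (k + 1) * ρ := by
  have hρ : 0 ≤ ρ := (abs_nonneg _).trans (hx p)
  have hk' : (1 : ℝ) ≤ k := by exact_mod_cast hk
  unfold recenter
  split_ifs with h
  · have h2 : |∑ t : Fin (k + 1), (if t.val = 0 then 0 else classMean (k + 1) m x t)| ≤ k * ρ := by
      rw [Fin.sum_univ_succ]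
      simp only [Fin.val_zero, if_true, zero_add, Fin.val_succ, Nat.add_eq_zero_iff, one_ne_zero,
        and_false, if_false]
      refine (Finset.abs_sum_le_sum_abs _ _).trans ?_
      refine (Finset.sum_le_sum fun t _ => abs_classMean_le hm hx t.succ).trans ?_
      simp
    linarith [abs_add_le (x p)
      (∑ t : Fin (k + 1), (if t.val = 0 then 0 else classMean (k + 1) m x t)), hx p]
  · have := abs_sub (x p) (classMean (k + 1) m x p.1)
    nlinarith [hx p, abs_classMean_le hm hx p.1]

theorem abs_edgeSum_le {r m : ℕ} {x : Fin r × Fin m → ℝ} {ρ : ℝ} (hx : ∀ p, |x p| ≤ ρ)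
    (e : Fin r → Fin m) : |edgeSum r m x e| ≤ r * ρ := by
  refine (Finset.abs_sum_le_sum_abs _ _).trans ?_
  refine (Finset.sum_le_sum fun t _ => hx (t, e t)).trans ?_
  simp

/-- Inside the box the integrand is at most a perturbed Gaussian plus an exponentially
small wider Gaussian. -/
theorem norm_Ffun_le_add (k m d : ℕ) (hk : 1 ≤ k) (hm : 0 < m) (hL : 0 < Lam (k + 1) m d)
    {ρ : ℝ} (hρ : (k + 1) * ((k + 1) * ρ) ^ 2 ≤ 3 / 40)
    (x : Fin (k + 1) × Fin m → ℝ) (hx : ∀ p, |x p| ≤ ρ) :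
    ‖Ffun (k + 1) m d x‖ ≤
      Real.exp (125 * ((k + 1) ^ 2 * m / (Lam (k + 1) m d * (m : ℝ) ^ k))) *
        Real.exp (∑ p, (-(Lam (k + 1) m d * (m : ℝ) ^ k / 2) * recenter (k + 1) m x p ^ 2 +
          5 / 12 * (Lam (k + 1) m d * (m : ℝ) ^ k) *
            truncQuartic ((k + 1) * ρ) (recenter (k + 1) m x p))) +
      Real.exp (-(5 / 4) * ((k + 1) * m)) *
        Real.exp (∑ p, (-(Lam (k + 1) m d * (m : ℝ) ^ k / 2 / 2) *
          recenter (k + 1) m x p ^ 2 + 0)) := by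
  have hm' : (0 : ℝ) < m := by positivity
  set A := Lam (k + 1) m d * (m : ℝ) ^ k with hA
  have hA0 : 0 < A := by positivity
  set y := recenter (k + 1) m x with hy
  set L := (k + 1) * ρ with hLdef
  have hyL : ∀ p, |y p| ≤ L := abs_recenter_le hk hm hx
  have hρ0 : 0 ≤ ρ := (abs_nonneg _).trans (hx (0, ⟨0, hm⟩))
  have hL0 : 0 ≤ L := by positivity
  have hk0 : (0 : ℝ) ≤ k := by positivity
  have hL2 : L ^ 2 ≤ 3 / 40 := by nlinarith [mul_nonneg hk0 (sq_nonneg L)]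
  have hL1 : L ≤ 1 := by nlinarith
  have hedge : ∀ e, |edgeSum (k + 1) m x e| ≤ 1 := fun e => by
    have := abs_edgeSum_le hx e
    push_cast at this
    exact this.trans hL1
  refine (norm_Ffun_le k m d hm hL.le x hedge).trans ?_
  rw [← hA, ← hy]
  have hy2 : ∀ p, y p ^ 2 ≤ L ^ 2 := fun p => by
    rw [← sq_abs (y p)]; exact pow_le_pow_left₀ (abs_nonneg _) (hyL p) 2
  set R := ∑ p, y p ^ 2 with hR
  have hR0 : 0 ≤ R := Finset.sum_nonneg fun p _ => sq_nonneg _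
  have htrunc : ∑ p, truncQuartic L (y p) = ∑ p, y p ^ 4 :=
    Finset.sum_congr rfl fun p _ => truncQuartic_eq (hyL p)
  simp only [Finset.sum_add_distrib, ← Finset.mul_sum, htrunc, ← hR, add_zero,
    ← Real.exp_add]
  set Q := ∑ p, y p ^ 4 with hQ
  rcases le_total (A * R) (10 * ((k + 1) * m)) with hcase | hcase
  · refine le_trans (Real.exp_le_exp.2 ?_) (le_add_of_nonneg_right (Real.exp_pos _).le)
    have h1 : A * (5 / 4 / m * R ^ 2) ≤ 125 * ((k + 1) ^ 2 * m / A) := by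
      have e1 : A * (5 / 4 / m * R ^ 2) = 5 / 4 * (A * R) ^ 2 / (m * A) := by field_simp
      have e2 : 125 * ((k + 1) ^ 2 * m / A) = 5 / 4 * (10 * ((k + 1) * m)) ^ 2 / (m * A) := by
        field_simp; ring
      rw [e1, e2]
      gcongr
    linarith
  · refine le_trans (Real.exp_le_exp.2 ?_) (le_add_of_nonneg_left (Real.exp_pos _).le)
    have hRn : R ≤ (k + 1) * m * L ^ 2 := by
      refine (Finset.sum_le_sum fun p _ => hy2 p).trans (le_of_eq ?_)
      simp
    have hQR : Q ≤ L ^ 2 * R := by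
      rw [hQ, hR, Finset.mul_sum]
      refine Finset.sum_le_sum fun p _ => ?_
      nlinarith [mul_le_mul_of_nonneg_right (hy2 p) (sq_nonneg (y p))]
    have h1 : 5 / 4 / m * R ^ 2 ≤ 3 / 32 * R := by
      have : R / m ≤ 3 / 40 := by
        rw [div_le_iff₀ hm']; nlinarith
      have e : 5 / 4 / m * R ^ 2 = 5 / 4 * (R / m) * R := by ring
      rw [e]
      nlinarith
    have h2 : 5 / 12 * Q ≤ 1 / 32 * R := by nlinarith
    have h3 : A * (-(1 / 2) * R + 5 / 12 * Q + 5 / 4 / m * R ^ 2) ≤ A * (-(3 / 8) * R) :=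
      mul_le_mul_of_nonneg_left (by linarith) hA0.le
    linarith

theorem exists_log_sq_le {c : ℝ} (hc : 0 < c) :
    ∃ N : ℕ, ∀ n : ℕ, N ≤ n → Real.log n ^ 2 ≤ c * n := by
  have h := (Real.isLittleO_pow_log_id_atTop (n := 2)).comp_tendsto tendsto_natCast_atTop_atTop
  obtain ⟨N, hN⟩ := eventually_atTop.1 (h.bound hc)
  refine ⟨N, fun n hn => ?_⟩
  simpa using hN n hn

theorem mul_rho0_sq_le {k m d : ℕ} {c : ℝ} (hc : 0 < c) (hm : 0 < m)
    (hA : c * ((k : ℝ) + 1) ^ 16 * m ≤ Lam (k + 1) m d * (m : ℝ) ^ k)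
    (hlog : Real.log ((k + 1) * m) ^ 2 ≤ 3 / 40 * c * ((k + 1) * m)) :
    (k + 1) * ((k + 1) * rho0 (k + 1) m d) ^ 2 ≤ 3 / 40 := by
  have hm' : (0 : ℝ) < m := by positivity
  have hr : (1 : ℝ) ≤ (k : ℝ) + 1 := by linarith [Nat.cast_nonneg (α := ℝ) k]
  set A := Lam (k + 1) m d * (m : ℝ) ^ k with hAdef
  have hA0 : 0 < A := lt_of_lt_of_le (by positivity) hA
  have h5 : (((k : ℝ) + 1) ^ ((5 : ℝ) / 2)) ^ 2 = ((k : ℝ) + 1) ^ 5 := by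
    rw [← Real.rpow_natCast, ← Real.rpow_mul (by positivity), ← Real.rpow_natCast]
    norm_num
  have e : (k + 1) * ((k + 1) * rho0 (k + 1) m d) ^ 2 =
      ((k : ℝ) + 1) ^ 8 * Real.log ((k + 1) * m) ^ 2 / A := by
    simp only [rho0, add_tsub_cancel_right]
    push_cast
    rw [← hAdef, mul_pow, div_pow, mul_pow, Real.sq_sqrt hA0.le, h5]
    ring
  rw [e, div_le_iff₀ hA0]
  calc _ ≤ ((k : ℝ) + 1) ^ 8 * (3 / 40 * c * ((k + 1) * m)) := by gcongr
    _ = 3 / 40 * (c * ((k : ℝ) + 1) ^ 9 * m) := by ring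
    _ ≤ 3 / 40 * (c * ((k : ℝ) + 1) ^ 16 * m) := by
        have := pow_le_pow_right₀ hr (by norm_num : 9 ≤ 16)
        gcongr
    _ ≤ 3 / 40 * A := by gcongr

theorem exp_add_exp_le {n : ℕ} (hn : 1 ≤ n) {a : ℝ} (ha : 0 ≤ a) :
    Real.exp a + Real.exp (-(3 / 4) * n) ≤ Real.exp (a + 2 * (n : ℝ) ^ (-(2 : ℝ) / 5)) := by
  have hn' : (1 : ℝ) ≤ n := by exact_mod_cast hn
  have h1 : Real.exp (-(3 / 4) * n) ≤ 2 * (n : ℝ) ^ (-(2 : ℝ) / 5) := by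
    have h2 : (n : ℝ)⁻¹ ≤ (n : ℝ) ^ (-(2 : ℝ) / 5) := by
      rw [← Real.rpow_neg_one]
      exact Real.rpow_le_rpow_of_exponent_le hn' (by norm_num)
    have h3 : Real.exp (-(3 / 4) * n) ≤ 2 * (n : ℝ)⁻¹ := by
      rw [neg_mul, Real.exp_neg, inv_le_iff_one_le_mul₀ (Real.exp_pos _)]
      have h4 := Real.add_one_le_exp (3 / 4 * (n : ℝ))
      calc (1 : ℝ) ≤ 2 * (n : ℝ)⁻¹ * (3 / 4 * n) := by field_simp; norm_num
        _ ≤ _ := by gcongr; linarith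
    linarith
  have h5 := Real.add_one_le_exp (2 * (n : ℝ) ^ (-(2 : ℝ) / 5))
  have h6 := Real.one_le_exp ha
  rw [Real.exp_add]
  have h7 : 0 ≤ (n : ℝ) ^ (-(2 : ℝ) / 5) := by positivity
  nlinarith

/-- for every `c > 0` there are `C > 0` and `N` such that whenever
`n = rm ≥ N`, `r ≥ 3`, `1 ≤ d ≤ m^{r−1} − 1` and `Λ ≥ c·r^16·m^{2−r}`,
`∫_{𝓑 ∩ U_n(ρ₀)} |F| ≤ m^{(r−1)/2} (2π/(Λ m^{r−1}))^{(n−r+1)/2}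
  exp(C(r²/(Λ m^{r−2}) + n^{−2/5}))`. -/
theorem abs_integral_inside_bound (c : ℝ) (hc : 0 < c) :
    ∃ C : ℝ, 0 < C ∧ ∃ N : ℕ, ∀ r m d : ℕ, 3 ≤ r → 1 ≤ m → N ≤ r * m →
      1 ≤ d → d ≤ m ^ (r - 1) - 1 →
      c * (r : ℝ) ^ 16 * (m : ℝ) ^ ((2 : ℤ) - (r : ℤ)) ≤ Lam r m d →
      (∫ θ in ext r m ⁻¹' (BSet r m ∩ Uball r m (rho0 r m d)),
          ‖Ffun r m d (ext r m θ)‖) ≤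
        denseBound r m d *
          Real.exp (C * ((r : ℝ) ^ 2 / (Lam r m d * (m : ℝ) ^ (r - 2)) +
            ((r * m : ℕ) : ℝ) ^ (-(2 : ℝ) / 5))) := by
  obtain ⟨N, hN⟩ := exists_log_sq_le (by positivity : 0 < 3 / 40 * c)
  refine ⟨233, by norm_num, N, fun r m d hr hm hn _ _ hΛ => ?_⟩
  obtain ⟨k, rfl⟩ : ∃ k, r = k + 2 := ⟨r - 2, by omega⟩
  have hm' : (0 : ℝ) < m := by exact_mod_cast hm
  set Λ := Lam (k + 2) m d with hΛdef
  have hΛ0 : 0 < Λ := lt_of_lt_of_le (by positivity) hΛ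
  set A := Λ * (m : ℝ) ^ (k + 1) with hA
  have hA0 : 0 < A := by positivity
  have hAc : c * (((k + 1 : ℕ) : ℝ) + 1) ^ 16 * m ≤ A := by
    have e : (m : ℝ) ^ ((2 : ℤ) - ((k + 2 : ℕ) : ℤ)) * (m : ℝ) ^ (k + 1) = m := by
      rw [← zpow_natCast, ← zpow_add₀ hm'.ne']
      push_cast
      rw [show (2 : ℤ) - (k + 2) + (k + 1) = 1 by ring, zpow_one]
    calc c * (((k + 1 : ℕ) : ℝ) + 1) ^ 16 * m = c * ((k + 2 : ℕ) : ℝ) ^ 16 *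
          ((m : ℝ) ^ ((2 : ℤ) - ((k + 2 : ℕ) : ℤ)) * (m : ℝ) ^ (k + 1)) := by
          rw [e]; push_cast; ring
      _ ≤ A := by
          rw [← mul_assoc]
          exact mul_le_mul_of_nonneg_right hΛ (by positivity)
  have hlog : Real.log ((((k + 1 : ℕ) : ℝ) + 1) * m) ^ 2 ≤
      3 / 40 * c * ((((k + 1 : ℕ) : ℝ) + 1) * m) := by
    have := hN _ hn
    push_cast at this ⊢
    convert this using 3 <;> ring_nf
  set ρ := rho0 (k + 2) m d with hρdef
  have hρ : (((k + 1 : ℕ) : ℝ) + 1) * ((((k + 1 : ℕ) : ℝ) + 1) * ρ) ^ 2 ≤ 3 / 40 :=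
    mul_rho0_sq_le hc hm hAc hlog
  set L := (((k + 1 : ℕ) : ℝ) + 1) * ρ with hLdef
  have hL2 : L ^ 2 ≤ 3 / 20 := by
    have hk0 : (0 : ℝ) ≤ ((k + 1 : ℕ) : ℝ) := by positivity
    nlinarith [mul_nonneg hk0 (sq_nonneg L)]
  have I1 := lintegral_recenter_ext_le (k + 1) m hm (q := 108 / A) hA0
    (fun y => 5 / 12 * A * truncQuartic L y) ((measurable_truncQuartic L).const_mul _)
    (fun y b => by
      have := mul_le_mul_of_nonneg_left (truncQuartic_midpoint L y b)
        (by positivity : 0 ≤ 5 / 12 * A)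
      linarith)
    (integrable_gaussian_truncQuartic hA0 hL2) (integral_gaussian_truncQuartic_le hA0 hL2)
  have I2 := lintegral_recenter_ext_le (k + 1) m hm (q := 0) (half_pos hA0)
    (fun _ => 0) measurable_const (fun y b => by simp)
    (by simpa using integrable_exp_neg_mul_sq (half_pos (half_pos hA0)))
    (by
      simp only [add_zero, Real.exp_zero, mul_one]
      rw [integral_gaussian]
      apply le_of_eq
      congr 1
      field_simp)
  set X := ((k + 2 : ℕ) : ℝ) ^ 2 / (Λ * (m : ℝ) ^ k) with hX
  have hX0 : 0 ≤ X := by positivity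
  have hXA : (((k + 1 : ℕ) : ℝ) + 1) ^ 2 * m / A = X := by
    rw [hX, hA]; push_cast; rw [pow_succ (m : ℝ) k]; field_simp; ring
  set n := (k + 1 + 1) * m with hndef
  have hn1 : 1 ≤ n := Nat.mul_pos (by omega) hm
  have hnX : (n : ℝ) * (108 / A) ≤ 108 * X := by
    have e : (n : ℝ) ≤ (((k + 1 : ℕ) : ℝ) + 1) ^ 2 * m := by
      rw [hndef]
      push_cast
      gcongr
      nlinarith [Nat.cast_nonneg (α := ℝ) k]
    have := div_le_div_of_nonneg_right e hA0.le
    rw [hXA] at this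
    calc _ = 108 * ((n : ℝ) / A) := by ring
      _ ≤ _ := by gcongr
  have hG : gaussMass (k + 1) m A = denseBound (k + 2) m d :=
    gaussMass_eq_denseBound (k + 1) m d hm hΛ0
  have hG0 := gaussMass_pos (k + 1) m hm hA0
  have hhalf := gaussMass_half_le (k + 1) m hm hA0
  set E1 := Real.exp (125 * X) with hE1
  set E2 := Real.exp (-(5 / 4) * n) with hE2
  have hlint : ∫⁻ θ in ext (k + 2) m ⁻¹' (BSet (k + 2) m ∩ Uball (k + 2) m ρ),
        ‖‖Ffun (k + 2) m d (ext (k + 2) m θ)‖‖ₑ ≤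
      ENNReal.ofReal (gaussMass (k + 1) m A * Real.exp (233 * X +
        2 * (n : ℝ) ^ (-(2 : ℝ) / 5))) := by
    set Φ1 := fun θ => ENNReal.ofReal (Real.exp (∑ p,
      (-(A / 2) * recenter (k + 2) m (ext (k + 2) m θ) p ^ 2 +
        5 / 12 * A * truncQuartic L (recenter (k + 2) m (ext (k + 2) m θ) p)))) with hΦ1
    set Φ2 := fun θ => ENNReal.ofReal (Real.exp (∑ p,
      (-(A / 2 / 2) * recenter (k + 2) m (ext (k + 2) m θ) p ^ 2 + 0))) with hΦ2
    have hrec : Measurable fun θ => recenter (k + 2) m (ext (k + 2) m θ) :=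
      (measurable_recenter _ m).comp (measurable_ext _ m)
    have hq := measurable_truncQuartic L
    have hM1 : Measurable Φ1 := by fun_prop
    have hM2 : Measurable Φ2 := by fun_prop
    have hle : ∀ θ ∈ ext (k + 2) m ⁻¹' (BSet (k + 2) m ∩ Uball (k + 2) m ρ),
        ‖‖Ffun (k + 2) m d (ext (k + 2) m θ)‖‖ₑ ≤
          ENNReal.ofReal E1 * Φ1 θ + ENNReal.ofReal E2 * Φ2 θ := fun θ hθ => by
      have := norm_Ffun_le_add (k + 1) m d (by omega) hm hΛ0 hρ (ext (k + 2) m θ)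
        (fun p => hθ.2 p)
      rw [← hA, hXA] at this
      have en : (((k + 1 : ℕ) : ℝ) + 1) * m = n := by rw [hndef]; push_cast; ring
      rw [en] at this
      rw [Real.enorm_of_nonneg (norm_nonneg _), hΦ1, hΦ2,
        ← ENNReal.ofReal_mul (Real.exp_pos _).le, ← ENNReal.ofReal_mul (Real.exp_pos _).le,
        ← ENNReal.ofReal_add (by positivity) (by positivity)]
      exact ENNReal.ofReal_le_ofReal this
    refine (setLIntegral_mono (by fun_prop) hle).trans ((setLIntegral_le_lintegral _ _).trans ?_)
    rw [lintegral_add_left (by fun_prop), lintegral_const_mul _ hM1, lintegral_const_mul _ hM2]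
    refine (add_le_add (mul_le_mul_right I1 _) (mul_le_mul_right I2 _)).trans ?_
    have hG2 := gaussMass_pos (k + 1) m hm (half_pos hA0)
    rw [← ENNReal.ofReal_mul (Real.exp_pos _).le, ← ENNReal.ofReal_mul (Real.exp_pos _).le,
      ← ENNReal.ofReal_add (by positivity) (by positivity)]
    refine ENNReal.ofReal_le_ofReal ?_
    rw [mul_zero, Real.exp_zero, mul_one]
    have h1 : E1 * Real.exp (n * (108 / A)) ≤ Real.exp (233 * X) := by
      rw [hE1, ← Real.exp_add]
      exact Real.exp_le_exp.2 (by linarith)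
    have h2 : E2 * Real.exp (n * (1 / 2)) = Real.exp (-(3 / 4) * n) := by
      rw [hE2, ← Real.exp_add]
      congr 1
      ring
    calc _ ≤ E1 * (gaussMass (k + 1) m A * Real.exp (n * (108 / A))) +
          E2 * (gaussMass (k + 1) m A * Real.exp (n * (1 / 2))) := by gcongr
      _ = gaussMass (k + 1) m A *
          (E1 * Real.exp (n * (108 / A)) + E2 * Real.exp (n * (1 / 2))) := by ring
      _ ≤ _ := by
        rw [h2]
        refine mul_le_mul_of_nonneg_left ?_ hG0.le
        exact (add_le_add_left h1 _).trans (exp_add_exp_le hn1 (by positivity))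
  have hfin := (enorm_integral_le_lintegral_enorm _).trans hlint
  rw [Real.enorm_of_nonneg (integral_nonneg fun _ => norm_nonneg _),
    ENNReal.ofReal_le_ofReal_iff (by positivity)] at hfin
  refine hfin.trans ?_
  rw [hG]
  have hpos : 0 ≤ denseBound (k + 2) m d := hG ▸ hG0.le
  have hn0 : 0 ≤ (n : ℝ) ^ (-(2 : ℝ) / 5) := by positivity
  refine mul_le_mul_of_nonneg_left (Real.exp_le_exp.2 ?_) hpos
  change _ ≤ 233 * (X + (n : ℝ) ^ (-(2 : ℝ) / 5))
  linarith
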